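/- Let B be a finite-dimensional Bol superalgebra over a field K of characteristic 0, let L(B) = B ⊕ IPS(B,B) be its standard enveloping Lie superalgebra with Killing form α, and let β be the Killing-Ricci form of B. Assume that α((D_{x,y}, x·y), z) = 0 for all homogeneous x,y,z ∈ B. Then β is nondegenerate on B if and only if α is nondegenerate on L(B). -/

import Mathlib

open LinearMap

/-- The sign `(-1)^(i·j)` in the ground field, for parities `i j : ZMod 2`. -/
def sgn (K : Type*) [Field K] (i j : ZMod 2) : K := (-1 : K) ^ (i * j).val

/-- A Bol superalgebra over `K`: a `ZMod 2`-graded vector space with a bilinear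
product `mul` and a trilinear bracket `tri` satisfying (BS1)–(BS5) on
homogeneous elements. -/
structure BolSuper (K : Type*) (B : Type*) [Field K] [AddCommGroup B] [Module K B] where
  g : ZMod 2 → Submodule K B
  internal : DirectSum.IsInternal g
  mul : B →ₗ[K] B →ₗ[K] B
  tri : B →ₗ[K] B →ₗ[K] B →ₗ[K] B
  mul_mem : ∀ i j x y, x ∈ g i → y ∈ g j → mul x y ∈ g (i + j)
  tri_mem : ∀ i j k x y z, x ∈ g i → y ∈ g j → z ∈ g k → tri x y z ∈ g (i + j + k)
  bs1 : ∀ i j x y, x ∈ g i → y ∈ g j → mul x y = -(sgn K i j • mul y x)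
  bs2 : ∀ i j k x y z, x ∈ g i → y ∈ g j → z ∈ g k → tri x y z = -(sgn K i j • tri y x z)
  bs3 : ∀ i j k x y z, x ∈ g i → y ∈ g j → z ∈ g k →
    tri x y z + sgn K i (j + k) • tri y z x + sgn K k (i + j) • tri z x y = 0
  bs4 : ∀ i j k l m x y u v w, x ∈ g i → y ∈ g j → u ∈ g k → v ∈ g l → w ∈ g m →
    tri x y (tri u v w) = tri (tri x y u) v w + sgn K k (i + j) • tri u (tri x y v) w
      + sgn K (i + j) (k + l) • tri u v (tri x y w)
  bs5 : ∀ i j k l x y u v, x ∈ g i → y ∈ g j → u ∈ g k → v ∈ g l →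
    tri x y (mul u v) = sgn K k (i + j) • mul u (tri x y v) + mul (tri x y u) v
      + sgn K (i + j) (k + l) • tri u v (mul x y) + mul (mul x y) (mul u v)

variable {K B L : Type*} [Field K] [AddCommGroup B] [Module K B]

/-- `P` is a pseudo superderivation of degree `r` of the Bol superalgebra `A`
with companion `a ∈ A.g r`. -/
def IsPSD (A : BolSuper K B) (r : ZMod 2) (P : B →ₗ[K] B) (a : B) : Prop :=
  a ∈ A.g r ∧
  (∀ i x, x ∈ A.g i → P x ∈ A.g (i + r)) ∧
  (∀ i j k x y z, x ∈ A.g i → y ∈ A.g j → z ∈ A.g k →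
    P (A.tri x y z) = A.tri (P x) y z + sgn K r i • A.tri x (P y) z
      + sgn K r (i + j) • A.tri x y (P z)) ∧
  (∀ i j x y, x ∈ A.g i → y ∈ A.g j →
    P (A.mul x y) = sgn K r i • A.mul x (P y) + A.mul (P x) y
      + sgn K r (i + j) • A.tri x y a + A.mul a (A.mul x y))

/-- The bracket on pairs (pseudo superderivation, companion), for degrees `r`, `s`. -/
def pbrk (A : BolSuper K B) (r s : ZMod 2)
    (pa qb : (B →ₗ[K] B) × B) : (B →ₗ[K] B) × B :=
  (pa.1 ∘ₗ qb.1 - sgn K r s • (qb.1 ∘ₗ pa.1),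
   pa.1 qb.2 - sgn K r s • qb.1 pa.2 - A.mul pa.2 qb.2)

/-- The bracket on `B ⊕ H` (elements encoded as pairs `(x, (P, a))`),
for degrees `r`, `s`. -/
def lbrk (A : BolSuper K B) (r s : ZMod 2)
    (u v : B × ((B →ₗ[K] B) × B)) : B × ((B →ₗ[K] B) × B) :=
  (u.2.1 v.1 - sgn K r s • v.2.1 u.1,
   (A.tri u.1 v.1 + (pbrk A r s u.2 v.2).1,
    A.mul u.1 v.1 + (pbrk A r s u.2 v.2).2))

/-- The degree-`r` part of the span of the inner pairs `(D_{x,u}, x·u)` with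
`x` homogeneous in `B` and `u` homogeneous in the graded subspace `S`. -/
def IPSpan (A : BolSuper K B) (S : ZMod 2 → Submodule K B) (r : ZMod 2) :
    Submodule K ((B →ₗ[K] B) × B) :=
  Submodule.span K {pa | ∃ i j x u, i + j = r ∧ x ∈ A.g i ∧ u ∈ S j ∧
    pa = (A.tri x u, A.mul x u)}

/-- Data presenting a Lie superalgebra `L` as the standard enveloping Lie
superalgebra `L(B) = B ⊕ IPS(B,B)` of the Bol superalgebra `A`, together with
the grading involution `sigma` used to define supertraces. -/
structure EnvSetup (K B L : Type*) [Field K] [AddCommGroup B] [Module K B]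
    [AddCommGroup L] [Module K L] (A : BolSuper K B) where
  brk : L →ₗ[K] L →ₗ[K] L
  iota : B →ₗ[K] L
  jmap : ((B →ₗ[K] B) × B) →ₗ[K] L
  gL : ZMod 2 → Submodule K L
  gL_eq : ∀ r, gL r = (A.g r).map iota ⊔ (IPSpan A A.g r).map jmap
  surj : ∀ v : L, ∃ x pa, pa ∈ IPSpan A A.g 0 ⊔ IPSpan A A.g 1 ∧ v = iota x + jmap pa
  inj : ∀ x pa, pa ∈ IPSpan A A.g 0 ⊔ IPSpan A A.g 1 → iota x + jmap pa = 0 →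
    x = 0 ∧ pa = 0
  brk_bb : ∀ x y : B, brk (iota x) (iota y) = jmap (A.tri x y, A.mul x y)
  brk_pb : ∀ r pa, pa ∈ IPSpan A A.g r → ∀ x : B, brk (jmap pa) (iota x) = iota (pa.1 x)
  brk_bp : ∀ r s x pa, x ∈ A.g r → pa ∈ IPSpan A A.g s →
    brk (iota x) (jmap pa) = -(sgn K r s • iota (pa.1 x))
  brk_pp : ∀ r s pa qb, pa ∈ IPSpan A A.g r → qb ∈ IPSpan A A.g s →
    brk (jmap pa) (jmap qb) = jmap (pbrk A r s pa qb)
  sigma : L →ₗ[K] L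
  sigma0 : ∀ v ∈ gL 0, sigma v = v
  sigma1 : ∀ v ∈ gL 1, sigma v = -v

variable [AddCommGroup L] [Module K L]

/-- The Killing form `α(u,v) = str(ad u ∘ ad v)` of the enveloping Lie
superalgebra, the supertrace being computed via the grading involution. -/
noncomputable def killing {A : BolSuper K B} (E : EnvSetup K B L A) (u v : L) : K :=
  LinearMap.trace K L (E.sigma ∘ₗ E.brk u ∘ₗ E.brk v)

/-- The Killing-Ricci form of `B`: the restriction of the Killing form of the
standard enveloping Lie superalgebra to `B × B`. -/
noncomputable def kr {A : BolSuper K B} (E : EnvSetup K B L A) (x y : B) : K :=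
  killing E (E.iota x) (E.iota y)

section Sign

variable (K)

@[simp] lemma sgn_zero_left (j : ZMod 2) : sgn K 0 j = 1 := by simp [sgn]

@[simp] lemma sgn_zero_right (i : ZMod 2) : sgn K i 0 = 1 := by simp [sgn]

@[simp] lemma sgn_one_one : sgn K 1 1 = -1 := by
  have : (1 * 1 : ZMod 2).val = 1 := rfl
  rw [sgn, this, pow_one]

lemma sgn_comm (i j : ZMod 2) : sgn K i j = sgn K j i := by rw [sgn, sgn, mul_comm]

lemma ZMod.two_one_add_one : (1 + 1 : ZMod 2) = 0 := rfl

lemma ZMod.two_eq_zero_or_one : ∀ i : ZMod 2, i = 0 ∨ i = 1 := by decide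

end Sign

/-- A Lie superalgebra, together with its parity involution. -/
structure LieSuper (K L : Type*) [Field K] [AddCommGroup L] [Module K L] where
  g : ZMod 2 → Submodule K L
  sup_eq_top : g 0 ⊔ g 1 = ⊤
  brk : L →ₗ[K] L →ₗ[K] L
  brk_mem : ∀ i j u v, u ∈ g i → v ∈ g j → brk u v ∈ g (i + j)
  skew : ∀ i j u v, u ∈ g i → v ∈ g j → brk u v = -(sgn K i j • brk v u)
  jacobi : ∀ i j k u v w, u ∈ g i → v ∈ g j → w ∈ g k →
    brk u (brk v w) = brk (brk u v) w + sgn K i j • brk v (brk u w)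
  sigma : L →ₗ[K] L
  sigma_apply : ∀ i, ∀ v ∈ g i, sigma v = sgn K i 1 • v

/-- Linear maps agreeing on the homogeneous elements are equal. -/
lemma linearMap_ext_of_sup_eq_top {V W : Type*} [AddCommGroup V] [Module K V]
    [AddCommGroup W] [Module K W] {g : ZMod 2 → Submodule K V} (hg : g 0 ⊔ g 1 = ⊤)
    {f f' : V →ₗ[K] W} (h : ∀ i, ∀ v ∈ g i, f v = f' v) : f = f' := by
  ext v
  obtain ⟨a, ha, b, hb, rfl⟩ := Submodule.mem_sup.1 (hg ▸ Submodule.mem_top : v ∈ g 0 ⊔ g 1)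
  rw [map_add, map_add, h 0 a ha, h 1 b hb]

namespace LieSuper

variable (S : LieSuper K L)

/-- The operator `ad u`, as an element of the endomorphism ring. -/
def ad : L →ₗ[K] Module.End K L := S.brk

/-- The right multiplication `x ↦ [x, v]`, as an element of the endomorphism ring. -/
def adR : L →ₗ[K] Module.End K L := S.brk.flip

/-- The parity involution, as an element of the endomorphism ring. -/
def par : Module.End K L := S.sigma

lemma par_apply {i : ZMod 2} {v : L} (hv : v ∈ S.g i) : S.par v = sgn K i 1 • v :=
  S.sigma_apply i v hv

lemma par_mul_par : S.par * S.par = 1 := by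
  refine linearMap_ext_of_sup_eq_top S.sup_eq_top fun i v hv => ?_
  rw [Module.End.mul_apply, S.par_apply hv, map_smul, S.par_apply hv]
  obtain rfl | rfl := ZMod.two_eq_zero_or_one i <;> simp

lemma par_par (v : L) : S.par (S.par v) = v := by
  rw [← Module.End.mul_apply, par_mul_par, Module.End.one_apply]

lemma ad_mem {i j : ZMod 2} {u v : L} (hu : u ∈ S.g i) (hv : v ∈ S.g j) :
    S.ad u v ∈ S.g (i + j) := S.brk_mem i j u v hu hv

lemma par_mul_ad {i : ZMod 2} {u : L} (hu : u ∈ S.g i) :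
    S.par * S.ad u = sgn K i 1 • (S.ad u * S.par) := by
  refine linearMap_ext_of_sup_eq_top S.sup_eq_top fun j v hv => ?_
  rw [Module.End.mul_apply, LinearMap.smul_apply, Module.End.mul_apply, S.par_apply hv,
    S.par_apply (S.ad_mem hu hv), map_smul]
  obtain rfl | rfl := ZMod.two_eq_zero_or_one i <;>
  obtain rfl | rfl := ZMod.two_eq_zero_or_one j <;> simp [ZMod.two_one_add_one]

lemma par_mul_ad_eq (u : L) : S.par * S.ad u = S.ad (S.par u) * S.par := by
  have : (LinearMap.mulLeft K S.par) ∘ₗ S.ad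
      = (LinearMap.mulRight K S.par) ∘ₗ S.ad ∘ₗ S.par := by
    refine linearMap_ext_of_sup_eq_top S.sup_eq_top fun j v hv => ?_
    simp [S.par_mul_ad hv, S.par_apply hv]
  exact LinearMap.congr_fun this u

lemma ad_ad {i j : ZMod 2} {u v : L} (hu : u ∈ S.g i) (hv : v ∈ S.g j) :
    S.ad (S.ad u v) = S.ad u * S.ad v - sgn K i j • (S.ad v * S.ad u) := by
  refine linearMap_ext_of_sup_eq_top S.sup_eq_top fun k w hw => ?_
  exact eq_sub_of_add_eq (S.jacobi i j k u v w hu hv hw).symm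

/-- The Killing form as a bilinear map. -/
noncomputable def form : L →ₗ[K] L →ₗ[K] K :=
  LinearMap.mk₂ K (fun u v => LinearMap.trace K L (S.par * S.ad u * S.ad v))
    (by intros; simp [mul_add, add_mul]) (by intros; simp)
    (by intros; simp [mul_add]) (by intros; simp)

lemma form_apply (u v : L) : S.form u v = LinearMap.trace K L (S.par * S.ad u * S.ad v) := rfl

lemma form_swap (u v : L) : S.form u v = S.form (S.par v) u := by
  rw [form_apply, form_apply, LinearMap.trace_mul_comm, ← mul_assoc, par_mul_ad_eq, mul_assoc,
    mul_assoc, par_par]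

lemma form_par_par (u v : L) : S.form (S.par u) (S.par v) = S.form u v := by
  rw [S.form_swap u v, S.form_swap (S.par v) u]

lemma form_eq_zero_swap {u : L} (h : ∀ v, S.form u v = 0) (v : L) : S.form v u = 0 := by
  rw [form_swap, ← S.form_par_par, par_par, h]

lemma form_par_eq_zero {u : L} (h : ∀ v, S.form u v = 0) (v : L) : S.form (S.par u) v = 0 := by
  rw [← S.form_par_par, par_par, h]

lemma form_ad [CharZero K] (u v w : L) : S.form (S.ad u v) w = S.form u (S.ad v w) := by
  suffices h : ∀ i, ∀ u ∈ S.g i, ∀ j, ∀ v ∈ S.g j, ∀ k, ∀ w ∈ S.g k,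
      S.form (S.ad u v) w = S.form u (S.ad v w) by
    have h₁ : ∀ i, ∀ u ∈ S.g i, ∀ j, ∀ v ∈ S.g j, ∀ w,
        S.form (S.ad u v) w = S.form u (S.ad v w) := fun i u hu j v hv w =>
      LinearMap.congr_fun (linearMap_ext_of_sup_eq_top S.sup_eq_top
        (f := S.form (S.ad u v)) (f' := S.form u ∘ₗ S.ad v) (h i u hu j v hv)) w
    have h₂ : ∀ i, ∀ u ∈ S.g i, ∀ v w,
        S.form (S.ad u v) w = S.form u (S.ad v w) := fun i u hu v w =>
      LinearMap.congr_fun (linearMap_ext_of_sup_eq_top S.sup_eq_top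
        (f := S.form.flip w ∘ₗ S.ad u) (f' := S.form u ∘ₗ S.adR w)
        fun j v hv => h₁ i u hu j v hv w) v
    exact LinearMap.congr_fun (linearMap_ext_of_sup_eq_top S.sup_eq_top
        (f := S.form.flip w ∘ₗ S.adR v)
        (f' := S.form.flip (S.ad v w)) fun i u hu => h₂ i u hu v w) u
  intro i u hu j v hv k w hw
  have hcyc : LinearMap.trace K L (S.par * S.ad u * (S.ad w * S.ad v))
      = sgn K j 1 * LinearMap.trace K L (S.par * S.ad v * S.ad u * S.ad w) := by
    rw [← mul_assoc, LinearMap.trace_mul_comm, ← mul_assoc, ← mul_assoc, S.par_mul_ad hv]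
    simp only [smul_mul_assoc, map_smul, smul_eq_mul, ← mul_assoc]
    obtain rfl | rfl := ZMod.two_eq_zero_or_one j <;> simp
  have hodd : LinearMap.trace K L (S.par * S.ad v * S.ad u * S.ad w)
      = sgn K j 1 * sgn K i 1 * sgn K k 1 *
        LinearMap.trace K L (S.par * S.ad v * S.ad u * S.ad w) := by
    have : S.par * S.ad v * S.ad u * S.ad w
        = (sgn K j 1 * sgn K i 1 * sgn K k 1) • (S.ad v * S.ad u * S.ad w * S.par) := by
      rw [S.par_mul_ad hv, smul_mul_assoc, smul_mul_assoc, mul_assoc _ S.par, S.par_mul_ad hu,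
        mul_smul_comm, smul_mul_assoc, ← mul_assoc, mul_assoc _ S.par, S.par_mul_ad hw,
        mul_smul_comm, smul_smul, smul_smul, ← mul_assoc]
    conv_lhs => rw [this, map_smul, LinearMap.trace_mul_comm, smul_eq_mul]
    simp only [← mul_assoc]
  rw [form_apply, form_apply, S.ad_ad hu hv, S.ad_ad hv hw]
  simp only [mul_sub, sub_mul, map_sub, mul_smul_comm, smul_mul_assoc, map_smul, smul_eq_mul, hcyc]
  simp only [← mul_assoc] at hodd ⊢
  congr 1
  obtain rfl | rfl := ZMod.two_eq_zero_or_one i <;>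
  obtain rfl | rfl := ZMod.two_eq_zero_or_one j <;>
  obtain rfl | rfl := ZMod.two_eq_zero_or_one k <;> simp at hodd ⊢ <;> grind

lemma jacobi_ad {i j : ZMod 2} {u v : L} (hu : u ∈ S.g i) (hv : v ∈ S.g j) (w : L) :
    S.ad u (S.ad v w) = S.ad (S.ad u v) w + sgn K i j • S.ad v (S.ad u w) := by
  rw [S.ad_ad hu hv]
  simp

/-- If the radical of the Killing form `α` is central, every linear functional `f` admits an
endomorphism `e` with `f [u, v] = α (e u, v)`. -/
lemma exists_form_eq [FiniteDimensional K L] [CharZero K]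
    (hcen : ∀ z, (∀ v, S.form z v = 0) → ∀ u, S.ad u z = 0) (f : L →ₗ[K] K) :
    ∃ e : Module.End K L, ∀ u v, S.form (e u) v = f (S.ad u v) := by
  have hrange (u : L) : f ∘ₗ S.ad u ∈ LinearMap.range S.form := by
    have h := LinearMap.dualAnnihilator_ker_eq_range_flip (B := S.form.flip)
    rw [LinearMap.flip_flip] at h
    rw [← h, Submodule.mem_dualAnnihilator]
    intro z hz
    have hz' (v : L) : S.form v z = 0 := LinearMap.congr_fun (LinearMap.mem_ker.1 hz) v
    rw [LinearMap.comp_apply, hcen z (fun v => by rw [form_swap, hz']), map_zero]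
  obtain ⟨e, he⟩ := Module.projective_lifting_property S.form.rangeRestrict
    (LinearMap.codRestrict (LinearMap.range S.form)
      ((LinearMap.llcomp K L L K f) ∘ₗ S.ad) hrange) S.form.surjective_rangeRestrict
  exact ⟨e, fun u v => LinearMap.congr_fun (congrArg Subtype.val (LinearMap.congr_fun he u)) v⟩

/-- If the radical of the Killing form is central, then it meets the derived algebra trivially. -/
lemma eq_zero_of_form_eq_zero [FiniteDimensional K L] [CharZero K]
    (hcen : ∀ z, (∀ v, S.form z v = 0) → ∀ u, S.ad u z = 0 ∧ S.ad z u = 0) {z : L}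
    (hz : ∀ v, S.form z v = 0)
    (hmem : z ∈ Submodule.span K {x | ∃ i j, ∃ u ∈ S.g i, ∃ v ∈ S.g j, x = S.ad u v}) :
    z = 0 := by
  rw [← Module.forall_dual_apply_eq_zero_iff K]
  intro f
  obtain ⟨e, he⟩ := S.exists_form_eq (fun z hz u => (hcen z hz u).1) f
  suffices h : f z = LinearMap.trace K L (S.par * e * S.ad z) by
    have : S.ad z = 0 := LinearMap.ext fun u => (hcen z hz u).2
    rw [h, this, mul_zero, map_zero]
  suffices h : ∀ i, ∀ v ∈ S.g i, ∀ j, ∀ w ∈ S.g j,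
      f (S.ad v w) = LinearMap.trace K L (S.par * e * S.ad (S.ad v w)) by
    clear hz
    induction hmem using Submodule.span_induction with
    | mem x hx =>
      obtain ⟨i, j, u, hu, v, hv, rfl⟩ := hx
      exact h i u hu j v hv
    | zero => simp
    | add x y _ _ hx hy => simp only [map_add, mul_add, hx, hy]
    | smul c x _ hx => simp only [map_smul, mul_smul_comm, hx]
  intro j v hv k w hw
  set r := S.adR v
  have hr_apply (u : L) : r u = S.ad u v := rfl
  obtain ⟨s, hs_apply, hs_ad⟩ : ∃ s : Module.End K L, (∀ i, ∀ u ∈ S.g i, s u = sgn K i j • u) ∧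
      (s = 1 ∧ j = 0 ∨ s = S.par ∧ j = 1) := by
    obtain rfl | rfl := ZMod.two_eq_zero_or_one j
    · exact ⟨1, by simp, by simp⟩
    · exact ⟨S.par, fun i u hu => S.par_apply hu, by simp⟩
  have hr_eq : r = -(S.ad v * s) := by
    refine linearMap_ext_of_sup_eq_top S.sup_eq_top fun i u hu => ?_
    rw [hr_apply, LinearMap.neg_apply, Module.End.mul_apply, hs_apply i u hu, map_smul]
    exact S.skew i j u v hu hv
  set n : Module.End K L := r * e - e * r - S.ad (e v) * s with hn
  have hn_rad (u : L) : ∀ x, S.form (n u) x = 0 := by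
    suffices h : S.form ∘ₗ n = 0 from fun x => LinearMap.congr_fun (LinearMap.congr_fun h u) x
    refine linearMap_ext_of_sup_eq_top S.sup_eq_top fun i u hu => ?_
    refine linearMap_ext_of_sup_eq_top S.sup_eq_top fun l x hx => ?_
    simp only [hn, LinearMap.comp_apply, LinearMap.sub_apply, Module.End.mul_apply, map_sub,
      hr_apply, hs_apply i u hu, map_smul, LinearMap.smul_apply, form_ad, he]
    rw [S.jacobi_ad hu hv x, map_add, map_smul]
    simp
  have hn_zero : S.ad w * S.par * n = 0 := by
    ext u
    exact (hcen _ (S.form_par_eq_zero (hn_rad u)) w).1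
  have htr : LinearMap.trace K L (S.par * n * s * S.ad w) = 0 := by
    rw [LinearMap.trace_mul_comm, ← mul_assoc, ← mul_assoc, hn_zero, zero_mul, map_zero]
  have had : S.ad (e v) * s = r * e - e * r - n := by rw [hn]; abel
  rw [← he, form_apply, S.ad_ad hv hw]
  obtain ⟨rfl, rfl⟩ | ⟨rfl, rfl⟩ := hs_ad
  · rw [mul_one] at had hr_eq htr
    have hcyc : LinearMap.trace K L (S.par * (S.ad v * e) * S.ad w)
        = LinearMap.trace K L (S.par * e * (S.ad w * S.ad v)) := by
      rw [← mul_assoc, S.par_mul_ad hv, sgn_zero_left, one_smul, mul_assoc, mul_assoc,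
        LinearMap.trace_mul_comm]
      simp only [mul_assoc]
    rw [had, hr_eq]
    simp only [mul_sub, sub_mul, map_sub, htr, neg_mul, mul_neg, map_neg, hcyc]
    simp [mul_assoc]
    ring
  · have had' : S.ad (e v) = (r * e - e * r - n) * S.par := by
      rw [← had, mul_assoc, par_mul_par, mul_one]
    have hpv : S.par * S.ad v = -(S.ad v * S.par) := by simp [S.par_mul_ad hv]
    have hcyc : LinearMap.trace K L (S.par * (S.ad v * S.par * e) * S.par * S.ad w)
        = sgn K 1 k * LinearMap.trace K L (S.par * e * (S.ad w * S.ad v)) := by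
      have h₁ : S.par * (S.ad v * S.par * e) * S.par * S.ad w
          = -(S.ad v * (e * S.par * S.ad w)) := by
        have : S.par * (S.ad v * S.par * e) * S.par * S.ad w
            = (S.par * S.ad v) * S.par * (e * S.par * S.ad w) := by simp only [mul_assoc]
        rw [this, hpv, neg_mul, neg_mul, mul_assoc (S.ad v), par_mul_par, mul_one]
      have h₂ : e * S.par * S.ad w * S.ad v
          = -(sgn K k 1 • ((e * (S.ad w * S.ad v)) * S.par)) := by
        rw [mul_assoc e, S.par_mul_ad hw, mul_smul_comm, smul_mul_assoc, ← smul_neg]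
        congr 1
        rw [mul_assoc, mul_assoc (S.ad w), hpv]
        simp only [mul_neg, mul_assoc]
      rw [h₁, map_neg, LinearMap.trace_mul_comm, h₂, map_neg, neg_neg, map_smul,
        LinearMap.trace_mul_comm, sgn_comm, smul_eq_mul, mul_assoc]
    have hsq : S.par * (e * (S.ad v * S.par)) * S.par * S.ad w
        = S.par * e * (S.ad v * S.ad w) := by
      simp only [mul_assoc]
      rw [← mul_assoc S.par S.par, par_mul_par, one_mul]
    rw [had', hr_eq]
    simp only [mul_sub, sub_mul, map_sub, neg_mul, mul_neg, map_neg]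
    simp only [mul_assoc] at htr hcyc hsq ⊢
    simp [htr, hcyc, hsq]
    ring

lemma ad_eq_of_even {v : L} (hv : v ∈ S.g 0) (u : L) : S.ad v u = -S.ad u v := by
  refine LinearMap.congr_fun (linearMap_ext_of_sup_eq_top S.sup_eq_top (f := S.ad v)
    (f' := -S.adR v) fun i w hw => ?_) u
  exact (S.skew 0 i v w hv hw).trans (by rw [sgn_zero_left, one_smul]; rfl)

lemma ad_eq_of_odd {v : L} (hv : v ∈ S.g 1) (u : L) : S.ad v u = -S.ad (S.par u) v := by
  refine LinearMap.congr_fun (linearMap_ext_of_sup_eq_top S.sup_eq_top (f := S.ad v)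
    (f' := (-S.adR v) ∘ₗ S.par) fun i w hw => ?_) u
  rw [LinearMap.comp_apply, S.par_apply hw, sgn_comm, map_smul]
  exact (S.skew 1 i v w hv hw).trans (smul_neg _ _).symm

lemma ad_apply_eq_zero_swap {j : ZMod 2} {u v : L} (hv : v ∈ S.g j) (h : S.ad u v = 0)
    (h' : S.ad (S.par u) v = 0) : S.ad v u = 0 := by
  obtain rfl | rfl := ZMod.two_eq_zero_or_one j
  · rw [S.ad_eq_of_even hv, h, neg_zero]
  · rw [S.ad_eq_of_odd hv, h', neg_zero]

lemma ad_apply_eq_zero_swap' {j : ZMod 2} {u v : L} (hv : v ∈ S.g j) (h : S.ad v u = 0)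
    (h' : S.ad v (S.par u) = 0) : S.ad u v = 0 := by
  obtain rfl | rfl := ZMod.two_eq_zero_or_one j
  · rw [← neg_eq_zero, ← S.ad_eq_of_even hv, h]
  · rw [← neg_eq_zero, ← S.par_par u, ← S.ad_eq_of_odd hv, h']

end LieSuper

namespace BolSuper

variable (A : BolSuper K B)

lemma sup_eq_top : A.g 0 ⊔ A.g 1 = ⊤ := by
  refine top_le_iff.1 (A.internal.submodule_iSup_eq_top ▸ iSup_le fun i => ?_)
  obtain rfl | rfl := ZMod.two_eq_zero_or_one i
  exacts [le_sup_left, le_sup_right]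

lemma pair_mem {i j : ZMod 2} {x y : B} (hx : x ∈ A.g i) (hy : y ∈ A.g j) :
    (A.tri x y, A.mul x y) ∈ IPSpan A A.g (i + j) :=
  Submodule.subset_span ⟨i, j, x, y, rfl, hx, hy, rfl⟩

lemma pair_mem_sup (x y : B) :
    (A.tri x y, A.mul x y) ∈ IPSpan A A.g 0 ⊔ IPSpan A A.g 1 := by
  have key {i j : ZMod 2} {x y : B} (hx : x ∈ A.g i) (hy : y ∈ A.g j) :
      (A.tri x y, A.mul x y) ∈ IPSpan A A.g 0 ⊔ IPSpan A A.g 1 := by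
    have h := A.pair_mem hx hy
    obtain hk | hk := ZMod.two_eq_zero_or_one (i + j) <;> rw [hk] at h
    exacts [le_sup_left (a := IPSpan A A.g 0) h, le_sup_right (a := IPSpan A A.g 0) h]
  obtain ⟨a, ha, b, hb, rfl⟩ :=
    Submodule.mem_sup.1 (A.sup_eq_top ▸ Submodule.mem_top : x ∈ A.g 0 ⊔ A.g 1)
  obtain ⟨c, hc, d, hd, rfl⟩ :=
    Submodule.mem_sup.1 (A.sup_eq_top ▸ Submodule.mem_top : y ∈ A.g 0 ⊔ A.g 1)
  have := add_mem (add_mem (key ha hc) (key ha hd)) (add_mem (key hb hc) (key hb hd))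
  convert this using 1
  refine Prod.ext ?_ ?_ <;> simp

/-- Every element of the degree-`r` inner span is a pseudo superderivation with its companion. -/
lemma isPSD_of_mem {r : ZMod 2} {pa : (B →ₗ[K] B) × B} (h : pa ∈ IPSpan A A.g r) :
    IsPSD A r pa.1 pa.2 := by
  induction h using Submodule.span_induction with
  | mem x hx =>
    obtain ⟨i, j, x, y, rfl, hx, hy, rfl⟩ := hx
    refine ⟨A.mul_mem i j x y hx hy, fun k z hz => ?_, fun k l m u v w hu hv hw => ?_,
      fun k l u v hu hv => ?_⟩
    · rw [add_comm]; exact A.tri_mem i j k x y z hx hy hz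
    · rw [sgn_comm K (i + j) k]; exact A.bs4 i j k l m x y u v w hx hy hu hv hw
    · rw [sgn_comm K (i + j) k]; exact A.bs5 i j k l x y u v hx hy hu hv
  | zero => exact ⟨zero_mem _, by simp, by simp, by simp⟩
  | add p q _ _ hp hq =>
    obtain ⟨hp₁, hp₂, hp₃, hp₄⟩ := hp
    obtain ⟨hq₁, hq₂, hq₃, hq₄⟩ := hq
    refine ⟨add_mem hp₁ hq₁, fun k z hz => add_mem (hp₂ k z hz) (hq₂ k z hz),
      fun k l m u v w hu hv hw => ?_, fun k l u v hu hv => ?_⟩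
    · simp only [Prod.fst_add, LinearMap.add_apply, map_add, smul_add,
        hp₃ k l m u v w hu hv hw, hq₃ k l m u v w hu hv hw]
      abel
    · simp only [Prod.fst_add, Prod.snd_add, LinearMap.add_apply, map_add, smul_add,
        hp₄ k l u v hu hv, hq₄ k l u v hu hv]
      abel
  | smul c p _ hp =>
    obtain ⟨hp₁, hp₂, hp₃, hp₄⟩ := hp
    refine ⟨Submodule.smul_mem _ c hp₁, fun k z hz => Submodule.smul_mem _ c (hp₂ k z hz),
      fun k l m u v w hu hv hw => ?_, fun k l u v hu hv => ?_⟩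
    · simp only [Prod.smul_fst, LinearMap.smul_apply, map_smul,
        hp₃ k l m u v w hu hv hw]
      module
    · simp only [Prod.smul_fst, Prod.smul_snd, LinearMap.smul_apply, map_smul,
        hp₄ k l u v hu hv]
      module

lemma pbrk_pair {r i j : ZMod 2} {pa : (B →ₗ[K] B) × B} (h : pa ∈ IPSpan A A.g r) {x y : B}
    (hx : x ∈ A.g i) (hy : y ∈ A.g j) :
    pbrk A r (i + j) pa (A.tri x y, A.mul x y)
      = (A.tri (pa.1 x) y, A.mul (pa.1 x) y)
        + sgn K r i • (A.tri x (pa.1 y), A.mul x (pa.1 y)) := by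
  obtain ⟨_, _, h₃, h₄⟩ := A.isPSD_of_mem h
  refine Prod.ext (linearMap_ext_of_sup_eq_top A.sup_eq_top fun k z hz => ?_) ?_
  · simp [pbrk, h₃ i j k x y z hx hy hz]
  · simp only [pbrk, h₄ i j x y hx hy, Prod.snd_add, Prod.smul_snd]
    abel

lemma pbrk_mem {r s : ZMod 2} {pa qb : (B →ₗ[K] B) × B} (hp : pa ∈ IPSpan A A.g r)
    (hq : qb ∈ IPSpan A A.g s) : pbrk A r s pa qb ∈ IPSpan A A.g (r + s) := by
  induction hq using Submodule.span_induction with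
  | mem x hx =>
    obtain ⟨i, j, x, y, rfl, hx, hy, rfl⟩ := hx
    rw [A.pbrk_pair hp hx hy]
    have hP := (A.isPSD_of_mem hp).2.1
    refine add_mem ?_ (Submodule.smul_mem _ _ ?_)
    · convert A.pair_mem (hP i x hx) hy using 2; ring
    · convert A.pair_mem hx (hP j y hy) using 2; ring
  | zero => convert zero_mem (IPSpan A A.g (r + s)) using 1; simp [pbrk]
  | add p q _ _ hp hq =>
    convert add_mem hp hq using 1
    refine Prod.ext (LinearMap.ext fun z => ?_) ?_ <;> simp [pbrk] <;> abel
  | smul c p _ hp =>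
    convert Submodule.smul_mem _ c hp using 1
    refine Prod.ext (LinearMap.ext fun z => ?_) ?_ <;> simp [pbrk] <;> module

lemma pbrk_skew {r s : ZMod 2} {pa qb : (B →ₗ[K] B) × B} (hp : pa ∈ IPSpan A A.g r)
    (hq : qb ∈ IPSpan A A.g s) : pbrk A r s pa qb = -(sgn K r s • pbrk A s r qb pa) := by
  have h := A.bs1 r s pa.2 qb.2 (A.isPSD_of_mem hp).1 (A.isPSD_of_mem hq).1
  refine Prod.ext (LinearMap.ext fun z => ?_) ?_
  · simp only [pbrk]
    obtain rfl | rfl := ZMod.two_eq_zero_or_one r <;>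
    obtain rfl | rfl := ZMod.two_eq_zero_or_one s <;> simp <;> abel
  · simp only [pbrk, Prod.snd_neg, Prod.smul_snd, h]
    obtain rfl | rfl := ZMod.two_eq_zero_or_one r <;>
    obtain rfl | rfl := ZMod.two_eq_zero_or_one s <;> (simp; abel)

lemma pair_skew {i j : ZMod 2} {x y : B} (hx : x ∈ A.g i) (hy : y ∈ A.g j) :
    (A.tri x y, A.mul x y) = -(sgn K i j • (A.tri y x, A.mul y x)) := by
  refine Prod.ext (linearMap_ext_of_sup_eq_top A.sup_eq_top fun k z hz => ?_) ?_
  · exact A.bs2 i j k x y z hx hy hz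
  · exact A.bs1 i j x y hx hy

end BolSuper

namespace EnvSetup

variable {A : BolSuper K B} (E : EnvSetup K B L A)

lemma iota_mem {i : ZMod 2} {x : B} (hx : x ∈ A.g i) : E.iota x ∈ E.gL i := by
  rw [E.gL_eq]
  exact Submodule.mem_sup_left (Submodule.mem_map_of_mem hx)

lemma jmap_mem {i : ZMod 2} {pa : (B →ₗ[K] B) × B} (h : pa ∈ IPSpan A A.g i) :
    E.jmap pa ∈ E.gL i := by
  rw [E.gL_eq]
  exact Submodule.mem_sup_right (Submodule.mem_map_of_mem h)

lemma gL_induction {i : ZMod 2} {p : (v : L) → v ∈ E.gL i → Prop}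
    (hiota : ∀ x (hx : x ∈ A.g i), p (E.iota x) (E.iota_mem hx))
    (hjmap : ∀ pa (hpa : pa ∈ IPSpan A A.g i), p (E.jmap pa) (E.jmap_mem hpa))
    (hadd : ∀ u v hu hv, p u hu → p v hv → p (u + v) (add_mem hu hv))
    {v : L} (hv : v ∈ E.gL i) : p v hv := by
  obtain ⟨_, ⟨x, hx, rfl⟩, _, ⟨pa, hpa, rfl⟩, rfl⟩ := Submodule.mem_sup.1 (E.gL_eq i ▸ hv)
  exact hadd _ _ _ _ (hiota x hx) (hjmap pa hpa)

lemma gL_sup_eq_top : E.gL 0 ⊔ E.gL 1 = ⊤ := by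
  refine top_le_iff.1 fun v _ => ?_
  obtain ⟨x, pa, hpa, rfl⟩ := E.surj v
  obtain ⟨a, ha, b, hb, rfl⟩ :=
    Submodule.mem_sup.1 (A.sup_eq_top ▸ Submodule.mem_top : x ∈ A.g 0 ⊔ A.g 1)
  obtain ⟨p, hp, q, hq, rfl⟩ := Submodule.mem_sup.1 hpa
  rw [map_add, map_add]
  exact add_mem
    (Submodule.add_mem_sup (E.iota_mem ha) (E.iota_mem hb))
    (Submodule.add_mem_sup (E.jmap_mem hp) (E.jmap_mem hq))

lemma brk_skew {i j : ZMod 2} {u v : L} (hu : u ∈ E.gL i) (hv : v ∈ E.gL j) :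
    E.brk u v = -(sgn K i j • E.brk v u) := by
  induction hu using E.gL_induction with
  | hiota x hx =>
    induction hv using E.gL_induction with
    | hiota y hy => rw [E.brk_bb, E.brk_bb, A.pair_skew hx hy, map_neg, map_smul]
    | hjmap q hq => rw [E.brk_bp i j x q hx hq, E.brk_pb j q hq]
    | hadd a b _ _ ha hb => simp only [map_add, LinearMap.add_apply, smul_add, ha, hb, neg_add]
  | hjmap p hp =>
    induction hv using E.gL_induction with
    | hiota y hy =>
      rw [E.brk_bp j i y p hy hp, E.brk_pb i p hp]
      obtain rfl | rfl := ZMod.two_eq_zero_or_one i <;>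
      obtain rfl | rfl := ZMod.two_eq_zero_or_one j <;> simp
    | hjmap q hq =>
      rw [E.brk_pp i j p q hp hq, E.brk_pp j i q p hq hp, A.pbrk_skew hp hq, map_neg, map_smul]
    | hadd a b _ _ ha hb => simp only [map_add, LinearMap.add_apply, smul_add, ha, hb, neg_add]
  | hadd a b _ _ ha hb => simp only [map_add, LinearMap.add_apply, smul_add, ha, hb, neg_add]

lemma brk_mem {i j : ZMod 2} {u v : L} (hu : u ∈ E.gL i) (hv : v ∈ E.gL j) :
    E.brk u v ∈ E.gL (i + j) := by
  induction hu using E.gL_induction with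
  | hiota x hx =>
    induction hv using E.gL_induction with
    | hiota y hy => rw [E.brk_bb]; exact E.jmap_mem (A.pair_mem hx hy)
    | hjmap q hq =>
      rw [E.brk_bp i j x q hx hq]
      exact neg_mem (Submodule.smul_mem _ _ (E.iota_mem ((A.isPSD_of_mem hq).2.1 i x hx)))
    | hadd a b _ _ ha hb => rw [map_add]; exact add_mem ha hb
  | hjmap p hp =>
    induction hv using E.gL_induction with
    | hiota y hy =>
      rw [E.brk_pb i p hp, add_comm]
      exact E.iota_mem ((A.isPSD_of_mem hp).2.1 j y hy)
    | hjmap q hq => rw [E.brk_pp i j p q hp hq]; exact E.jmap_mem (A.pbrk_mem hp hq)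
    | hadd a b _ _ ha hb => rw [map_add]; exact add_mem ha hb
  | hadd a b _ _ ha hb => rw [map_add, LinearMap.add_apply]; exact add_mem ha hb

/-- The Jacobi identity for three elements, the first two being of degree `i` and `j`. -/
def Jacobi (i j : ZMod 2) (u v w : L) : Prop :=
  E.brk u (E.brk v w) = E.brk (E.brk u v) w + sgn K i j • E.brk v (E.brk u w)

variable {E} {i j k : ZMod 2} {u v w : L}

lemma Jacobi.swap_left (hu : u ∈ E.gL i) (hv : v ∈ E.gL j) (h : E.Jacobi i j u v w) :
    E.Jacobi j i v u w := by
  unfold Jacobi at *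
  rw [E.brk_skew hv hu, h, sgn_comm K j i]
  obtain rfl | rfl := ZMod.two_eq_zero_or_one i <;>
  obtain rfl | rfl := ZMod.two_eq_zero_or_one j <;> simp

lemma Jacobi.swap_right (hu : u ∈ E.gL i) (hv : v ∈ E.gL j) (hw : w ∈ E.gL k)
    (h : E.Jacobi i j u v w) : E.Jacobi i k u w v := by
  unfold Jacobi at *
  rw [E.brk_skew hw hv, map_neg, map_smul, h, E.brk_skew (E.brk_mem hu hv) hw,
    E.brk_skew hv (E.brk_mem hu hw)]
  obtain rfl | rfl := ZMod.two_eq_zero_or_one i <;>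
  obtain rfl | rfl := ZMod.two_eq_zero_or_one j <;>
  obtain rfl | rfl := ZMod.two_eq_zero_or_one k <;> simp [ZMod.two_one_add_one]

variable (E)

lemma jacobi_iota_iota_iota {x y z : B} (hx : x ∈ A.g i) (hy : y ∈ A.g j) (hz : z ∈ A.g k) :
    E.Jacobi i j (E.iota x) (E.iota y) (E.iota z) := by
  have h := congrArg E.iota (A.bs3 i j k x y z hx hy hz)
  rw [A.bs2 k i j z x y hz hx hy] at h
  simp only [map_add, map_neg, map_smul, map_zero] at h
  unfold Jacobi
  rw [E.brk_bb, E.brk_bb, E.brk_bb, E.brk_bp i _ x _ hx (A.pair_mem hy hz),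
    E.brk_bp j _ y _ hy (A.pair_mem hx hz), E.brk_pb _ _ (A.pair_mem hx hy)]
  rw [eq_comm, ← sub_eq_zero, ← h]
  obtain rfl | rfl := ZMod.two_eq_zero_or_one i <;>
  obtain rfl | rfl := ZMod.two_eq_zero_or_one j <;>
  obtain rfl | rfl := ZMod.two_eq_zero_or_one k <;> simp [ZMod.two_one_add_one] <;> abel

lemma jacobi_jmap_iota_iota {p : (B →ₗ[K] B) × B} {x y : B} (hp : p ∈ IPSpan A A.g i)
    (hx : x ∈ A.g j) (hy : y ∈ A.g k) : E.Jacobi i j (E.jmap p) (E.iota x) (E.iota y) := by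
  unfold Jacobi
  rw [E.brk_bb, E.brk_pp i (j + k) p _ hp (A.pair_mem hx hy), A.pbrk_pair hp hx hy,
    E.brk_pb i p hp, E.brk_pb i p hp, E.brk_bb, E.brk_bb, map_add, map_smul]

lemma jacobi_jmap_jmap_iota {p q : (B →ₗ[K] B) × B} (hp : p ∈ IPSpan A A.g i)
    (hq : q ∈ IPSpan A A.g j) (x : B) : E.Jacobi i j (E.jmap p) (E.jmap q) (E.iota x) := by
  unfold Jacobi
  rw [E.brk_pb j q hq, E.brk_pb i p hp, E.brk_pp i j p q hp hq,
    E.brk_pb _ _ (A.pbrk_mem hp hq), E.brk_pb i p hp, E.brk_pb j q hq]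
  simp [pbrk]

lemma jacobi_jmap_jmap_jmap {p q t : (B →ₗ[K] B) × B} (hp : p ∈ IPSpan A A.g i)
    (hq : q ∈ IPSpan A A.g j) (ht : t ∈ IPSpan A A.g k) :
    E.Jacobi i j (E.jmap p) (E.jmap q) (E.jmap t) := by
  induction ht using Submodule.span_induction with
  | mem t ht =>
    obtain ⟨l, m, x, y, -, hx, hy, rfl⟩ := ht
    have hP := (A.isPSD_of_mem hp).2.1
    have hQ := (A.isPSD_of_mem hq).2.1
    have hpq := E.jacobi_jmap_iota_iota (A.pbrk_mem hp hq) hx hy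
    have h₁ := E.jacobi_jmap_iota_iota hp (hQ l x hx) hy
    have h₂ := E.jacobi_jmap_iota_iota hp hx (hQ m y hy)
    have h₃ := E.jacobi_jmap_iota_iota hq (hP l x hx) hy
    have h₄ := E.jacobi_jmap_iota_iota hq hx (hP m y hy)
    have h₅ := E.jacobi_jmap_iota_iota hp hx hy
    have h₆ := E.jacobi_jmap_iota_iota hq hx hy
    have hx' := E.jacobi_jmap_jmap_iota hp hq x
    have hy' := E.jacobi_jmap_jmap_iota hp hq y
    unfold Jacobi at *
    rw [← E.brk_pp i j p q hp hq, ← sub_eq_iff_eq_add.2 hx', ← sub_eq_iff_eq_add.2 hy'] at hpq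
    simp only [E.brk_pb i p hp, E.brk_pb j q hq] at h₁ h₂ h₃ h₄ h₅ h₆ hpq
    rw [← E.brk_bb, h₆, h₅, hpq]
    simp only [map_add, map_sub, map_smul, LinearMap.sub_apply, LinearMap.smul_apply, h₁, h₂, h₃, h₄]
    obtain rfl | rfl := ZMod.two_eq_zero_or_one i <;>
    obtain rfl | rfl := ZMod.two_eq_zero_or_one j <;>
    obtain rfl | rfl := ZMod.two_eq_zero_or_one l <;>
    simp [ZMod.two_one_add_one] <;> abel
  | zero => simp [Jacobi]
  | add a b _ _ ha hb =>
    unfold Jacobi at *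
    simp only [map_add, ha, hb, smul_add]; abel
  | smul c a _ ha =>
    unfold Jacobi at *
    simp only [map_smul, ha, smul_add, smul_comm c]

lemma jacobi (hu : u ∈ E.gL i) (hv : v ∈ E.gL j) (hw : w ∈ E.gL k) : E.Jacobi i j u v w := by
  have hadd₁ {u u' v w : L} (h : E.Jacobi i j u v w) (h' : E.Jacobi i j u' v w) :
      E.Jacobi i j (u + u') v w := by
    unfold Jacobi at *
    simp only [map_add, LinearMap.add_apply, h, h', smul_add]; abel
  have hadd₂ {u v v' w : L} (h : E.Jacobi i j u v w) (h' : E.Jacobi i j u v' w) :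
      E.Jacobi i j u (v + v') w := by
    unfold Jacobi at *
    simp only [map_add, LinearMap.add_apply, h, h', smul_add]; abel
  have hadd₃ {u v w w' : L} (h : E.Jacobi i j u v w) (h' : E.Jacobi i j u v w') :
      E.Jacobi i j u v (w + w') := by
    unfold Jacobi at *
    simp only [map_add, h, h', smul_add]; abel
  induction hu using E.gL_induction with
  | hadd a b _ _ ha hb => exact hadd₁ ha hb
  | hiota x hx =>
    have hx' := E.iota_mem hx
    induction hv using E.gL_induction with
    | hadd a b _ _ ha hb => exact hadd₂ ha hb
    | hiota y hy =>
      have hy' := E.iota_mem hy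
      induction hw using E.gL_induction with
      | hadd a b _ _ ha hb => exact hadd₃ ha hb
      | hiota z hz => exact E.jacobi_iota_iota_iota hx hy hz
      | hjmap t ht =>
        have ht' := E.jmap_mem ht
        exact ((E.jacobi_jmap_iota_iota ht hx hy).swap_left ht' hx').swap_right hx' ht' hy'
    | hjmap q hq =>
      have hq' := E.jmap_mem hq
      induction hw using E.gL_induction with
      | hadd a b _ _ ha hb => exact hadd₃ ha hb
      | hiota z hz => exact (E.jacobi_jmap_iota_iota hq hx hz).swap_left hq' hx'
      | hjmap t ht =>
        have ht' := E.jmap_mem ht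
        exact ((E.jacobi_jmap_jmap_iota hq ht x).swap_right hq' ht' hx').swap_left hq' hx'
  | hjmap p hp =>
    have hp' := E.jmap_mem hp
    induction hv using E.gL_induction with
    | hadd a b _ _ ha hb => exact hadd₂ ha hb
    | hiota y hy =>
      have hy' := E.iota_mem hy
      induction hw using E.gL_induction with
      | hadd a b _ _ ha hb => exact hadd₃ ha hb
      | hiota z hz => exact E.jacobi_jmap_iota_iota hp hy hz
      | hjmap t ht =>
        exact (E.jacobi_jmap_jmap_iota hp ht y).swap_right hp' (E.jmap_mem ht) hy'
    | hjmap q hq =>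
      induction hw using E.gL_induction with
      | hadd a b _ _ ha hb => exact hadd₃ ha hb
      | hiota z hz => exact E.jacobi_jmap_jmap_iota hp hq z
      | hjmap t ht => exact E.jacobi_jmap_jmap_jmap hp hq ht

/-- The standard enveloping Lie superalgebra. -/
def toLieSuper : LieSuper K L where
  g := E.gL
  sup_eq_top := E.gL_sup_eq_top
  brk := E.brk
  brk_mem _ _ _ _ := E.brk_mem
  skew _ _ _ _ := E.brk_skew
  jacobi _ _ _ _ _ _ := E.jacobi
  sigma := E.sigma
  sigma_apply i v hv := by
    obtain rfl | rfl := ZMod.two_eq_zero_or_one i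
    · simpa using E.sigma0 v hv
    · simpa using E.sigma1 v hv

lemma toLieSuper_form (u v : L) : E.toLieSuper.form u v = killing E u v := rfl

/-- The hypothesis that the inner pairs are orthogonal to `B`, extended by linearity. -/
lemma form_jmap_iota (halpha0 : ∀ (i j k : ZMod 2) (x y z : B),
      x ∈ A.g i → y ∈ A.g j → z ∈ A.g k →
      killing E (E.jmap (A.tri x y, A.mul x y)) (E.iota z) = 0)
    {p : (B →ₗ[K] B) × B} (hp : p ∈ IPSpan A A.g 0 ⊔ IPSpan A A.g 1) (z : B) :
    E.toLieSuper.form (E.jmap p) (E.iota z) = 0 := by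
  have key {r : ZMod 2} {p : (B →ₗ[K] B) × B} (hp : p ∈ IPSpan A A.g r) :
      E.toLieSuper.form (E.jmap p) ∘ₗ E.iota = 0 := by
    refine linearMap_ext_of_sup_eq_top A.sup_eq_top fun k z hz => ?_
    induction hp using Submodule.span_induction with
    | mem p hp =>
      obtain ⟨i, j, x, y, -, hx, hy, rfl⟩ := hp
      exact halpha0 i j k x y z hx hy hz
    | zero => simp
    | add a b _ _ ha hb =>
      rw [LinearMap.comp_apply, LinearMap.zero_apply] at ha hb ⊢
      rw [map_add, map_add, LinearMap.add_apply, ha, hb, add_zero]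
    | smul c a _ ha =>
      rw [LinearMap.comp_apply, LinearMap.zero_apply] at ha ⊢
      rw [map_smul, map_smul, LinearMap.smul_apply, ha, smul_zero]
  obtain ⟨a, ha, b, hb, rfl⟩ := Submodule.mem_sup.1 hp
  have h₁ := LinearMap.congr_fun (key ha) z
  have h₂ := LinearMap.congr_fun (key hb) z
  simp only [LinearMap.comp_apply, LinearMap.zero_apply] at h₁ h₂
  rw [map_add, map_add, LinearMap.add_apply, h₁, h₂, add_zero]

lemma par_jmap {p : (B →ₗ[K] B) × B} (hp : p ∈ IPSpan A A.g 0 ⊔ IPSpan A A.g 1) :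
    ∃ q ∈ IPSpan A A.g 0 ⊔ IPSpan A A.g 1, E.toLieSuper.par (E.jmap p) = E.jmap q := by
  obtain ⟨a, ha, b, hb, rfl⟩ := Submodule.mem_sup.1 hp
  refine ⟨a - b, sub_mem (Submodule.mem_sup_left ha) (Submodule.mem_sup_right hb), ?_⟩
  rw [map_add, map_add, E.toLieSuper.par_apply (E.jmap_mem ha),
    E.toLieSuper.par_apply (E.jmap_mem hb)]
  simp [sub_eq_add_neg]

lemma jmap_mem_span {p : (B →ₗ[K] B) × B} (hp : p ∈ IPSpan A A.g 0 ⊔ IPSpan A A.g 1) :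
    E.jmap p ∈ Submodule.span K {x | ∃ i j, ∃ u ∈ E.toLieSuper.g i, ∃ v ∈ E.toLieSuper.g j,
      x = E.toLieSuper.ad u v} := by
  have key (r : ZMod 2) : IPSpan A A.g r ≤ (Submodule.span K {x | ∃ i j,
      ∃ u ∈ E.toLieSuper.g i, ∃ v ∈ E.toLieSuper.g j, x = E.toLieSuper.ad u v}).comap E.jmap := by
    refine Submodule.span_le.2 ?_
    rintro _ ⟨i, j, x, y, -, hx, hy, rfl⟩
    exact Submodule.subset_span
      ⟨i, j, E.iota x, E.iota_mem hx, E.iota y, E.iota_mem hy, (E.brk_bb x y).symm⟩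
  exact sup_le (key 0) (key 1) hp

/-- If the radical of the Killing form lies in the image of the
inner pairs, then it is central. -/
lemma radical_central [CharZero K] (hrad : ∀ u, (∀ v, E.toLieSuper.form u v = 0) →
      ∃ p ∈ IPSpan A A.g 0 ⊔ IPSpan A A.g 1, u = E.jmap p)
    {u : L} (hu : ∀ v, E.toLieSuper.form u v = 0) (v : L) :
    E.toLieSuper.ad v u = 0 ∧ E.toLieSuper.ad u v = 0 := by
  set S := E.toLieSuper
  have hright {u : L} (hu : ∀ v, S.form u v = 0) (x : B) : S.ad u (E.iota x) = 0 := by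
    obtain ⟨q, hq, hqe⟩ := hrad (S.ad u (E.iota x)) fun w => by rw [S.form_ad, hu]
    obtain ⟨p, hp, rfl⟩ := hrad u hu
    obtain ⟨a, ha, b, hb, rfl⟩ := Submodule.mem_sup.1 hp
    have h : S.ad (E.jmap (a + b)) (E.iota x) = E.iota (a.1 x + b.1 x) := by
      rw [map_add, map_add, LinearMap.add_apply, map_add]
      exact congrArg₂ (· + ·) (E.brk_pb 0 a ha x) (E.brk_pb 1 b hb x)
    have h0 := (E.inj (a.1 x + b.1 x) (-q) (neg_mem hq)
      (by rw [map_neg, ← h, ← hqe, add_neg_cancel])).1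
    rw [h, h0, map_zero]
  have hiota {u : L} (hu : ∀ v, S.form u v = 0) {i : ZMod 2} {x : B} (hx : x ∈ A.g i) :
      S.ad (E.iota x) u = 0 :=
    S.ad_apply_eq_zero_swap (E.iota_mem hx) (hright hu x) (hright (S.form_par_eq_zero hu) x)
  have hleft {u : L} (hu : ∀ v, S.form u v = 0) {i : ZMod 2} {v : L} (hv : v ∈ S.g i) :
      S.ad v u = 0 := by
    induction hv using E.gL_induction with
    | hiota x hx => exact hiota hu hx
    | hjmap p hp =>
      induction hp using Submodule.span_induction with
      | mem p hp =>
        obtain ⟨k, l, x, y, -, hx, hy, rfl⟩ := hp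
        rw [← E.brk_bb]
        have h := LinearMap.congr_fun (S.ad_ad (E.iota_mem hx) (E.iota_mem hy)) u
        refine h.trans ?_
        simp [hiota hu hx, hiota hu hy]
      | zero => simp
      | add a b _ _ ha hb => rw [map_add, map_add, LinearMap.add_apply, ha, hb, add_zero]
      | smul c a _ ha => rw [map_smul, map_smul, LinearMap.smul_apply, ha, smul_zero]
    | hadd a b _ _ ha hb => rw [map_add, LinearMap.add_apply, ha, hb, add_zero]
  constructor
  · exact LinearMap.congr_fun (linearMap_ext_of_sup_eq_top S.sup_eq_top
      (f := S.adR u) (f' := 0) fun i w hw => hleft hu hw) v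
  · exact LinearMap.congr_fun (linearMap_ext_of_sup_eq_top S.sup_eq_top
      (f := S.ad u) (f' := 0) fun i w hw => S.ad_apply_eq_zero_swap' hw (hleft hu hw)
        (hleft (S.form_par_eq_zero hu) hw)) v

end EnvSetup

/-- assuming `α((D_{x,y},x·y), z) = 0` for all homogeneous
`x,y,z ∈ B`, the Killing-Ricci form `β` of `B` is nondegenerate if and only if
the Killing form `α` of the standard enveloping Lie superalgebra `L(B)` is
nondegenerate. -/
theorem stmt13 {K B L : Type*} [Field K] [CharZero K]
    [AddCommGroup B] [Module K B] [FiniteDimensional K B]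
    [AddCommGroup L] [Module K L] [FiniteDimensional K L]
    (A : BolSuper K B) (E : EnvSetup K B L A)
    (halpha0 : ∀ (i j k : ZMod 2) (x y z : B),
      x ∈ A.g i → y ∈ A.g j → z ∈ A.g k →
      killing E (E.jmap (A.tri x y, A.mul x y)) (E.iota z) = 0) :
    (∀ x : B, (∀ y : B, kr E x y = 0) → x = 0) ↔
      (∀ u : L, (∀ v : L, killing E u v = 0) → u = 0) := by
  constructor
  · intro hβ u hu
    have hrad (u : L) (hu : ∀ v, E.toLieSuper.form u v = 0) :
        ∃ p ∈ IPSpan A A.g 0 ⊔ IPSpan A A.g 1, u = E.jmap p := by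
      obtain ⟨x, p, hp, rfl⟩ := E.surj u
      have hx : x = 0 := hβ x fun y => by
        have := hu (E.iota y)
        rwa [map_add, LinearMap.add_apply, E.form_jmap_iota halpha0 hp, add_zero] at this
      exact ⟨p, hp, by rw [hx, map_zero, zero_add]⟩
    obtain ⟨p, hp, rfl⟩ := hrad u hu
    exact E.toLieSuper.eq_zero_of_form_eq_zero (fun z hz v => E.radical_central hrad hz v) hu
      (E.jmap_mem_span hp)
  · intro hα x hx
    refine (E.inj x 0 (zero_mem _) ?_).1
    rw [map_zero, add_zero]
    refine hα _ fun v => ?_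
    obtain ⟨y, p, hp, rfl⟩ := E.surj v
    obtain ⟨q, hq, hpq⟩ := E.par_jmap hp
    rw [← E.toLieSuper_form, map_add, E.toLieSuper.form_swap _ (E.jmap p), hpq,
      E.form_jmap_iota halpha0 hq, add_zero]
    exact hx y
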